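/- Let A = ⟨Σ,Q,q₀,Δ,w⟩ be a weighted finite automaton with weights in {−1,0,1}, and let G be the weighted pushdown game constructed from A via the five-gadget reduction. Then: (1) if there is a word ρ ∈ Σ* with L_A(ρ) ≥ 1, then player 1 has a finite-memory winning strategy in G for the objectives LimSupAvg(π) > 0 and LimInfAvg(π) > 0; (2) if every word ρ ∈ Σ* satisfies L_A(ρ) ≤ 0, then player 1 has no winning strategy in G for the objectives LimSupAvg(π) > 0 and LimInfAvg(π) > 0; consequently, (3) player 1 has a winning strategy (equivalently, a finite-memory winning strategy) in G for these objectives if and only if there is a word ρ ∈ Σ* with L_A(ρ) ≥ 1. -/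

import Mathlib

open scoped BigOperators

namespace PDS

/-- Stack commands over a stack alphabet `Γ`. -/
inductive Com (Γ : Type) where
  | skip : Com Γ
  | pop : Com Γ
  | push (z : Γ) : Com Γ
  deriving DecidableEq

/-- Action of a stack command on a stack string (top of stack at the head). -/
def Com.apply {Γ : Type} : Com Γ → List Γ → List Γ
  | .skip, α => α
  | .pop, α => α.tail
  | .push z, α => z :: α

/-- A transition (edge) of a pushdown system. -/
structure Edge (Q Γ : Type) where
  q1 : Q
  top : Γ
  q2 : Q
  com : Com Γ
  deriving DecidableEq

/-- A weighted pushdown system. -/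
structure WPS (Q Γ : Type) where
  q0 : Q
  bot : Γ
  E : Set (Edge Q Γ)
  w : Edge Q Γ → ℤ
  no_push_bot : ∀ e ∈ E, e.com ≠ Com.push bot
  no_pop_bot : ∀ e ∈ E, e.top = bot → e.com ≠ Com.pop

variable {Q Γ : Type}

/-- A configuration: stack string (top at head) together with a state. -/
abbrev Config (Q Γ : Type) := List Γ × Q

/-- A genuine configuration has a nonempty stack string. -/
def IsConfig (c : Config Q Γ) : Prop := c.1 ≠ []

/-- The initial configuration `(⊥, q₀)`. -/
def WPS.start (A : WPS Q Γ) : Config Q Γ := ([A.bot], A.q0)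

/-- The configuration obtained by taking the edge `e` from `c`. -/
def next (c : Config Q Γ) (e : Edge Q Γ) : Config Q Γ := (e.com.apply c.1, e.q2)

/-- The edge `e` is enabled at configuration `c`. -/
def WPS.Enabled (A : WPS Q Γ) (c : Config Q Γ) (e : Edge Q Γ) : Prop :=
  e ∈ A.E ∧ c.2 = e.q1 ∧ c.1.head? = some e.top

/-- Validity of a finite path, given by a start configuration and a list of edges. -/
def WPS.Valid (A : WPS Q Γ) : Config Q Γ → List (Edge Q Γ) → Prop
  | _, [] => True
  | c, e :: es => A.Enabled c e ∧ A.Valid (next c e) es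

/-- Last configuration of the finite path `(c, es)`. -/
def endc (c : Config Q Γ) (es : List (Edge Q Γ)) : Config Q Γ := es.foldl next c

/-- The list of configurations along the finite path `(c, es)`. -/
def trace (c : Config Q Γ) (es : List (Edge Q Γ)) : List (Config Q Γ) :=
  List.scanl next c es

/-- Total weight of a finite path. -/
def WPS.wt (A : WPS Q Γ) (es : List (Edge Q Γ)) : ℤ := (es.map A.w).sum

/-- Stack height of a configuration. -/
def height (c : Config Q Γ) : ℕ := c.1.length

/-- Stack height of a finite path: maximal stack height along it. -/
def SH (c : Config Q Γ) (es : List (Edge Q Γ)) : ℕ :=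
  ((trace c es).map height).foldr max 0

/-- Additional stack height of a finite path. -/
def ASH (c : Config Q Γ) (es : List (Edge Q Γ)) : ℕ :=
  SH c es - max (height c) (height (endc c es))

/-- The first configuration of the path is a local minima: its stack string is a
prefix (here: suffix of the list, since the top is at the head) of all stack strings
along the path. -/
def FirstMin (c : Config Q Γ) (es : List (Edge Q Γ)) : Prop :=
  ∀ c' ∈ trace c es, c.1 <:+ c'.1

/-- The edge sequence obtained from `u ++ p₁ ++ v ++ p₂ ++ x` by repeating `p₁` and
`p₂` each `j` times in place. -/
def pumped (u p₁ v p₂ x : List (Edge Q Γ)) (j : ℕ) : List (Edge Q Γ) :=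
  u ++ (List.replicate j p₁).flatten ++ v ++ (List.replicate j p₂).flatten ++ x

/-- `(p₁, p₂)` is a pumpable pair of paths for the path `(c, es)`. -/
def WPS.PumpablePair (A : WPS Q Γ) (c : Config Q Γ) (es p₁ p₂ : List (Edge Q Γ)) : Prop :=
  p₁ ≠ [] ∧ p₂ ≠ [] ∧
    ∃ u v x, es = u ++ p₁ ++ v ++ p₂ ++ x ∧
      ∀ j : ℕ, A.Valid c (pumped u p₁ v p₂ x j)

/-- The path `(c, es)` has a pumpable pair of paths. -/
def WPS.HasPumpablePair (A : WPS Q Γ) (c : Config Q Γ) (es : List (Edge Q Γ)) : Prop :=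
  ∃ p₁ p₂, A.PumpablePair c es p₁ p₂

/-- `(c, es)` is a good cycle. -/
def WPS.GoodCycle (A : WPS Q Γ) (c : Config Q Γ) (es : List (Edge Q Γ)) : Prop :=
  A.Valid c es ∧ 0 < A.wt es ∧ FirstMin c es ∧
    (endc c es).2 = c.2 ∧ (endc c es).1.head? = c.1.head?

/-- `A` has a good cycle reachable from the configuration `c`. -/
def WPS.ReachableGoodCycleFrom (A : WPS Q Γ) (c : Config Q Γ) : Prop :=
  ∃ es₀ es, A.Valid c es₀ ∧ A.GoodCycle (endc c es₀) es

/-- `A` has a good cycle (at some configuration). -/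
def WPS.HasGoodCycle (A : WPS Q Γ) : Prop :=
  ∃ c es, IsConfig c ∧ A.GoodCycle c es

/-- The finite path `(c, es)` contains a good cycle. -/
def ContainsGoodCycle (A : WPS Q Γ) (c : Config Q Γ) (es : List (Edge Q Γ)) : Prop :=
  ∃ es₁ es₂, es = es₁ ++ es₂ ∧ A.GoodCycle (endc c es₁) es₂

/-- Configurations along an infinite path given by an infinite edge sequence. -/
def confs (c : Config Q Γ) (f : ℕ → Edge Q Γ) : ℕ → Config Q Γ
  | 0 => c
  | n + 1 => next (confs c f n) (f n)

/-- Validity of the infinite path `(c, f)`. -/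
def WPS.ValidInf (A : WPS Q Γ) (c : Config Q Γ) (f : ℕ → Edge Q Γ) : Prop :=
  ∀ n, A.Enabled (confs c f n) (f n)

/-- Average weight of the prefix of length `n+1` of an infinite path. -/
noncomputable def avgPref (A : WPS Q Γ) (f : ℕ → Edge Q Γ) (n : ℕ) : ℝ :=
  (∑ i ∈ Finset.range (n + 1), (A.w (f i) : ℝ)) / (n + 1)

/-- Limit-sup of the averages along an infinite path. -/
noncomputable def LimSupAvg (A : WPS Q Γ) (f : ℕ → Edge Q Γ) : ℝ :=
  Filter.limsup (avgPref A f) Filter.atTop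

/-- Limit-inf of the averages along an infinite path. -/
noncomputable def LimInfAvg (A : WPS Q Γ) (f : ℕ → Edge Q Γ) : ℝ :=
  Filter.liminf (avgPref A f) Filter.atTop

/-- An infinite edge sequence is ultimately periodic. -/
def UltPeriodic (f : ℕ → Edge Q Γ) : Prop :=
  ∃ N p : ℕ, 0 < p ∧ ∀ n, N ≤ n → f (n + p) = f n

/-- The infinite path `(c, f)` is stack bounded. -/
def StackBounded (c : Config Q Γ) (f : ℕ → Edge Q Γ) : Prop :=
  ∃ n : ℕ, ∀ k, height (confs c f k) ≤ n

/-- Non-decreasing path: a valid path whose first configuration is a local minima. -/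
def WPS.NonDec (A : WPS Q Γ) (c : Config Q Γ) (es : List (Edge Q Γ)) : Prop :=
  A.Valid c es ∧ FirstMin c es

/-- Summary function, valued in `EReal`: `⊥` means there is no non-decreasing path
from `(⊥γ,q₁)` to `(⊥γ,q₂)`, `⊤` means `ω` (weights unbounded from above), and
otherwise the value is the maximal weight of such a path. -/
noncomputable def WPS.summary (A : WPS Q Γ) (q₁ : Q) (γ : Γ) (q₂ : Q) : EReal :=
  sSup { x : EReal | ∃ es, A.NonDec ([γ, A.bot], q₁) es ∧
    endc ([γ, A.bot], q₁) es = ([γ, A.bot], q₂) ∧ x = ((A.wt es : ℝ) : EReal) }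

/-- Stack height bounded summary function: as `summary` but only over non-decreasing
paths of additional stack height at most `d`. -/
noncomputable def WPS.summaryBdd (A : WPS Q Γ) (d : ℕ) (q₁ : Q) (γ : Γ) (q₂ : Q) : EReal :=
  sSup { x : EReal | ∃ es, A.NonDec ([γ, A.bot], q₁) es ∧
    endc ([γ, A.bot], q₁) es = ([γ, A.bot], q₂) ∧ ASH ([γ, A.bot], q₁) es ≤ d ∧
    x = ((A.wt es : ℝ) : EReal) }

/-- Edges of the summary graph `Gr(A)` together with their weights in `EReal`
(`⊤` plays the role of `ω`): skip edges weighted by the summary function and push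
edges weighted by the corresponding transition weight. -/
def WPS.GrEdge (A : WPS Q Γ) (v₁ v₂ : Q × Γ) (x : EReal) : Prop :=
  (v₁.2 = v₂.2 ∧ A.summary v₁.1 v₁.2 v₂.1 ≠ ⊥ ∧ x = A.summary v₁.1 v₁.2 v₂.1) ∨
  (∃ e ∈ A.E, e.q1 = v₁.1 ∧ e.top = v₁.2 ∧ e.q2 = v₂.1 ∧ e.com = Com.push v₂.2 ∧
    x = ((A.w e : ℝ) : EReal))

/-- The summary graph `Gr(A)` has a positive simple cycle: a simple cycle containing
an `ω`-edge or whose total weight is positive. -/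
def WPS.PosSimpleCycle (A : WPS Q Γ) : Prop :=
  ∃ (k : ℕ) (v : Fin (k + 1) → Q × Γ) (x : Fin (k + 1) → EReal),
    Function.Injective v ∧ (∀ i, A.GrEdge (v i) (v (i + 1)) (x i)) ∧
    ((∃ i, x i = ⊤) ∨ (0 : EReal) < ∑ i, x i)

/-- Weight of a finite path under the shifted weight function `w + r`. -/
def WPS.wtQ (A : WPS Q Γ) (r : ℚ) (es : List (Edge Q Γ)) : ℚ :=
  (es.map (fun e => (A.w e : ℚ) + r)).sum

/-- The shifted system `A^r` (weight function `w + r`) has a good cycle. -/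
def WPS.GoodCycleShift (A : WPS Q Γ) (r : ℚ) : Prop :=
  ∃ c es, IsConfig c ∧ A.Valid c es ∧ 0 < A.wtQ r es ∧ FirstMin c es ∧
    (endc c es).2 = c.2 ∧ (endc c es).1.head? = c.1.head?

end PDS

namespace PDS

/-- A weighted pushdown game: a WPS together with a partition of the states into
player-1 states (`p1`) and player-2 states (the rest). -/
structure WPG (Q Γ : Type) extends WPS Q Γ where
  p1 : Q → Prop

variable {Q Γ : Type}

/-- A strategy: given the history of edges taken so far (the play starts at the
initial configuration), choose the next edge. -/
abbrev Strat (Q Γ : Type) := List (Edge Q Γ) → Edge Q Γ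

/-- A player-1 strategy proposes enabled edges at every player-1 configuration that
is reachable consistently and has some enabled edge. -/
def WPG.ValidStrat1 (G : WPG Q Γ) (σ : Strat Q Γ) : Prop :=
  ∀ es : List (Edge Q Γ), G.toWPS.Valid G.toWPS.start es →
    G.p1 (endc G.toWPS.start es).2 →
    (∃ e, G.toWPS.Enabled (endc G.toWPS.start es) e) →
    G.toWPS.Enabled (endc G.toWPS.start es) (σ es)

/-- A player-2 strategy proposes enabled edges at every player-2 configuration. -/
def WPG.ValidStrat2 (G : WPG Q Γ) (σ : Strat Q Γ) : Prop :=
  ∀ es : List (Edge Q Γ), G.toWPS.Valid G.toWPS.start es →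
    ¬ G.p1 (endc G.toWPS.start es).2 →
    (∃ e, G.toWPS.Enabled (endc G.toWPS.start es) e) →
    G.toWPS.Enabled (endc G.toWPS.start es) (σ es)

/-- An infinite play (from the initial configuration) consistent with a player-1
strategy. -/
def WPG.Consistent1 (G : WPG Q Γ) (σ : Strat Q Γ) (f : ℕ → Edge Q Γ) : Prop :=
  G.toWPS.ValidInf G.toWPS.start f ∧
    ∀ n, G.p1 (confs G.toWPS.start f n).2 →
      f n = σ (List.ofFn (fun i : Fin n => f i))

/-- An infinite play consistent with a player-2 strategy. -/
def WPG.Consistent2 (G : WPG Q Γ) (σ : Strat Q Γ) (f : ℕ → Edge Q Γ) : Prop :=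
  G.toWPS.ValidInf G.toWPS.start f ∧
    ∀ n, ¬ G.p1 (confs G.toWPS.start f n).2 →
      f n = σ (List.ofFn (fun i : Fin n => f i))

/-- `σ` is a winning strategy for player 1 for the objective `obj`. -/
def WPG.Winning1 (G : WPG Q Γ) (σ : Strat Q Γ) (obj : (ℕ → Edge Q Γ) → Prop) : Prop :=
  G.ValidStrat1 σ ∧ ∀ f, G.Consistent1 σ f → obj f

/-- `σ` is a winning strategy for player 2 for the objective `obj`. -/
def WPG.Winning2 (G : WPG Q Γ) (σ : Strat Q Γ) (obj : (ℕ → Edge Q Γ) → Prop) : Prop :=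
  G.ValidStrat2 σ ∧ ∀ f, G.Consistent2 σ f → obj f

/-- A strategy is finite-memory if it is implementable by a finite-state transducer. -/
def FiniteMemory (σ : Strat Q Γ) : Prop :=
  ∃ (M : Type) (_ : Fintype M) (m₀ : M) (upd : M → Edge Q Γ → M) (out : M → Edge Q Γ),
    ∀ es, σ es = out (es.foldl upd m₀)

end PDS

namespace PDS

/-- States of the game constructed from a WFA with state set `QA`:
`q_$`, `q_Σ`, `q_ch`, `q_{<$}` and one state per automaton state. -/
inductive GSt (QA : Type) where
  | qd : GSt QA
  | qs : GSt QA
  | qch : GSt QA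
  | qlt : GSt QA
  | qa (q : QA) : GSt QA
  deriving DecidableEq

/-- Stack alphabet of the constructed game: `⊥`, `$`, and the letters of `Σ`. -/
inductive GSy (S : Type) where
  | bot : GSy S
  | dollar : GSy S
  | ltr (s : S) : GSy S
  deriving DecidableEq

variable {S QA : Type}

/-- The transitions of the five-gadget game constructed from the WFA
`⟨S, QA, q0A, Δ, wA⟩`. -/
def gadgetE (Δ : Set (QA × S × QA)) (q0A : QA) : Set (Edge (GSt QA) (GSy S)) :=
  { e | (∃ γ, e = ⟨.qd, γ, .qd, .push .dollar⟩) ∨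
        (∃ γ, e = ⟨.qd, γ, .qs, .push .dollar⟩) ∨
        (∃ γ s, e = ⟨.qs, γ, .qs, .push (.ltr s)⟩) ∨
        (∃ γ, e = ⟨.qs, γ, .qch, .skip⟩) ∨
        (∃ γ, e = ⟨.qch, γ, .qlt, .skip⟩) ∨
        (∃ γ, e = ⟨.qch, γ, .qa q0A, .skip⟩) ∨
        (∃ s, e = ⟨.qlt, .ltr s, .qlt, .pop⟩) ∨
        (e = ⟨.qlt, .dollar, .qlt, .pop⟩) ∨
        (e = ⟨.qlt, .bot, .qd, .skip⟩) ∨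
        (∃ q s q', (q, s, q') ∈ Δ ∧ e = ⟨.qa q, .ltr s, .qa q', .pop⟩) ∨
        (∃ q, e = ⟨.qa q, .dollar, .qa q, .pop⟩) ∨
        (∃ q, e = ⟨.qa q, .bot, .qd, .skip⟩) }

/-- The weight function of the five-gadget game. -/
def gadgetW (wA : QA × S × QA → ℤ) : Edge (GSt QA) (GSy S) → ℤ := fun e =>
  match e.q1, e.top, e.q2 with
  | .qd, _, _ => -10
  | .qs, _, .qch => 0
  | .qs, _, _ => -1
  | .qch, _, _ => 0
  | .qlt, .dollar, _ => 11
  | .qlt, _, _ => 0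
  | .qa q, .ltr s, .qa q' => wA (q, s, q') + 1
  | .qa _, .dollar, _ => 10
  | .qa _, _, _ => 0

/-- The WPG `G` constructed from the WFA `⟨S, QA, q0A, Δ, wA⟩` via the five-gadget
reduction. -/
def gadgetGame (Δ : Set (QA × S × QA)) (wA : QA × S × QA → ℤ) (q0A : QA) :
    WPG (GSt QA) (GSy S) where
  q0 := .qd
  bot := .bot
  E := gadgetE Δ q0A
  w := gadgetW wA
  p1 := fun q => q = .qd ∨ q = .qs
  no_push_bot := by
    intro e he
    simp only [gadgetE, Set.mem_setOf_eq] at he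
    rcases he with ⟨γ, rfl⟩ | ⟨γ, rfl⟩ | ⟨γ, s, rfl⟩ | ⟨γ, rfl⟩ | ⟨γ, rfl⟩ | ⟨γ, rfl⟩ |
      ⟨s, rfl⟩ | rfl | rfl | ⟨q, s, q', hq, rfl⟩ | ⟨q, rfl⟩ | ⟨q, rfl⟩ <;> simp
  no_pop_bot := by
    intro e he
    simp only [gadgetE, Set.mem_setOf_eq] at he
    rcases he with ⟨γ, rfl⟩ | ⟨γ, rfl⟩ | ⟨γ, s, rfl⟩ | ⟨γ, rfl⟩ | ⟨γ, rfl⟩ | ⟨γ, rfl⟩ |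
      ⟨s, rfl⟩ | rfl | rfl | ⟨q, s, q', hq, rfl⟩ | ⟨q, rfl⟩ | ⟨q, rfl⟩ <;> simp

/-- `RunW Δ wA q ρ z` holds iff the WFA has a run on the word `ρ` starting at state
`q` with total weight `z`. -/
inductive RunW (Δ : Set (QA × S × QA)) (wA : QA × S × QA → ℤ) :
    QA → List S → ℤ → Prop where
  | nil (q : QA) : RunW Δ wA q [] 0
  | cons {q q' : QA} {s : S} {ρ : List S} {z : ℤ} :
      (q, s, q') ∈ Δ → RunW Δ wA q' ρ z → RunW Δ wA q (s :: ρ) (wA (q, s, q') + z)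

end PDS

namespace PDS

section Averages

variable {Q Γ : Type}

/-- Averages of a bounded weight function stay within the same bounds. -/
lemma abs_avgPref_le (A : WPS Q Γ) {B : ℝ} (hB : ∀ e, |(A.w e : ℝ)| ≤ B) (f : ℕ → Edge Q Γ)
    (n : ℕ) : |avgPref A f n| ≤ B := by
  have hn : (0 : ℝ) < n + 1 := by positivity
  rw [avgPref, abs_div, abs_of_pos hn, div_le_iff₀ hn]
  calc |∑ i ∈ Finset.range (n + 1), (A.w (f i) : ℝ)|
      ≤ ∑ i ∈ Finset.range (n + 1), |(A.w (f i) : ℝ)| := Finset.abs_sum_le_sum_abs _ _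
    _ ≤ ∑ _i ∈ Finset.range (n + 1), B := Finset.sum_le_sum fun i _ => hB _
    _ = B * (n + 1) := by simp [mul_comm]

lemma limInfAvg_le_limSupAvg (A : WPS Q Γ) {B : ℝ} (hB : ∀ e, |(A.w e : ℝ)| ≤ B)
    (f : ℕ → Edge Q Γ) : LimInfAvg A f ≤ LimSupAvg A f :=
  Filter.liminf_le_limsup
    (Filter.isBoundedUnder_of ⟨B, fun n => (abs_le.1 (abs_avgPref_le A hB f n)).2⟩)
    (Filter.isBoundedUnder_of ⟨-B, fun n => (abs_le.1 (abs_avgPref_le A hB f n)).1⟩)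

/-- If all partial sums are nonpositive then so is the limit-sup average. -/
lemma limSupAvg_nonpos (A : WPS Q Γ) {B : ℝ} (hB : ∀ e, |(A.w e : ℝ)| ≤ B) (f : ℕ → Edge Q Γ)
    (h : ∀ n, ∑ i ∈ Finset.range n, A.w (f i) ≤ 0) : LimSupAvg A f ≤ 0 := by
  refine Filter.limsup_le_of_le (Filter.IsBoundedUnder.isCoboundedUnder_le
    (Filter.isBoundedUnder_of ⟨-B, fun n => (abs_le.1 (abs_avgPref_le A hB f n)).1⟩)) ?_
  filter_upwards with n
  refine div_nonpos_of_nonpos_of_nonneg ?_ (by positivity)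
  exact_mod_cast h (n + 1)

/-- If the partial sums grow at least linearly then the limit-inf average is positive. -/
lemma limInfAvg_pos (A : WPS Q Γ) {B : ℝ} (hB : ∀ e, |(A.w e : ℝ)| ≤ B) (f : ℕ → Edge Q Γ)
    {L : ℝ} (C : ℝ) (hL : 0 < L)
    (h : ∀ n : ℕ, (n : ℝ) ≤ L * (∑ i ∈ Finset.range n, (A.w (f i) : ℝ)) + C) :
    0 < LimInfAvg A f := by
  have hpos : (0 : ℝ) < 1 / (2 * L) := by positivity
  refine hpos.trans_le ?_
  refine Filter.le_liminf_of_le (Filter.IsBoundedUnder.isCoboundedUnder_ge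
    (Filter.isBoundedUnder_of ⟨B, fun n => (abs_le.1 (abs_avgPref_le A hB f n)).2⟩)) ?_
  filter_upwards [Filter.eventually_ge_atTop ⌈2 * C⌉₊] with n hn
  have hC : 2 * C ≤ n := (Nat.le_ceil _).trans (by exact_mod_cast hn)
  have hn' : (0 : ℝ) < n + 1 := by positivity
  have := h (n + 1)
  push_cast at this
  rw [avgPref, div_le_div_iff₀ (by positivity) hn']
  linarith

end Averages

section Paths

variable {Q Γ : Type}

lemma endc_concat (c : Config Q Γ) (es : List (Edge Q Γ)) (e : Edge Q Γ) :
    endc c (es ++ [e]) = next (endc c es) e := by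
  simp [endc]

lemma WPS.valid_concat (A : WPS Q Γ) (c : Config Q Γ) (es : List (Edge Q Γ)) (e : Edge Q Γ) :
    A.Valid c (es ++ [e]) ↔ A.Valid c es ∧ A.Enabled (endc c es) e := by
  induction es generalizing c with
  | nil => simp [WPS.Valid, endc]
  | cons e' es ih =>
    simp only [List.cons_append, WPS.Valid, ih, and_assoc]
    rfl

lemma WPS.wt_concat (A : WPS Q Γ) (es : List (Edge Q Γ)) (e : Edge Q Γ) :
    A.wt (es ++ [e]) = A.wt es + A.w e := by
  simp [WPS.wt]

lemma ofFn_succ_eq_concat {α : Type} (f : ℕ → α) (n : ℕ) :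
    List.ofFn (fun i : Fin (n + 1) => f i) = List.ofFn (fun i : Fin n => f i) ++ [f n] := by
  rw [List.ofFn_succ', List.concat_eq_append]
  rfl

lemma confs_eq_endc (c : Config Q Γ) (f : ℕ → Edge Q Γ) (n : ℕ) :
    confs c f n = endc c (List.ofFn fun i : Fin n => f i) := by
  induction n with
  | zero => rfl
  | succ n ih => rw [ofFn_succ_eq_concat, endc_concat, ← ih]; rfl

lemma WPS.wt_ofFn (A : WPS Q Γ) (f : ℕ → Edge Q Γ) (n : ℕ) :
    A.wt (List.ofFn fun i : Fin n => f i) = ∑ i ∈ Finset.range n, A.w (f i) := by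
  induction n with
  | zero => rfl
  | succ n ih => rw [ofFn_succ_eq_concat, A.wt_concat, ih, Finset.sum_range_succ]

/-- An invariant on histories that can always be extended, following `σ` at the player-1
configurations, is maintained along some infinite play consistent with `σ`. -/
lemma WPG.exists_consistent1 (G : WPG Q Γ) (σ : Strat Q Γ) (I : List (Edge Q Γ) → Prop)
    (h0 : I [])
    (hI : ∀ es, I es → ∃ e, G.toWPS.Enabled (endc G.toWPS.start es) e ∧ I (es ++ [e]) ∧
      (G.p1 (endc G.toWPS.start es).2 → e = σ es)) :
    ∃ f, G.Consistent1 σ f ∧ ∀ n : ℕ, I (List.ofFn fun i : Fin n => f i) := by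
  have : Nonempty (Edge Q Γ) := ⟨(hI [] h0).choose⟩
  choose! g hen hext hσ using hI
  let H : ℕ → List (Edge Q Γ) := fun n => Nat.rec [] (fun _ es => es ++ [g es]) n
  have hH : ∀ n, I (H n) := by
    intro n
    induction n with
    | zero => exact h0
    | succ n ih => exact hext _ ih
  have hof : ∀ n : ℕ, (List.ofFn fun i : Fin n => g (H i)) = H n := by
    intro n
    induction n with
    | zero => rfl
    | succ n ih => rw [ofFn_succ_eq_concat (fun i => g (H i)), ih]
  refine ⟨fun n => g (H n), ⟨fun n => ?_, fun n hn => ?_⟩, fun n => ?_⟩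
  · rw [confs_eq_endc, hof]
    exact hen _ (hH n)
  · rw [confs_eq_endc, hof] at hn
    rw [hof]
    exact hσ _ (hH n) hn
  · rw [hof]
    exact hH n

end Paths

variable {S QA : Type}

lemma abs_gadgetW_le {wA : QA × S × QA → ℤ} (hwr : ∀ t, wA t = -1 ∨ wA t = 0 ∨ wA t = 1)
    (e : Edge (GSt QA) (GSy S)) : |((gadgetW wA e : ℤ) : ℝ)| ≤ 11 := by
  have h : |gadgetW wA e| ≤ 11 := by
    rw [abs_le]
    unfold gadgetW
    split <;> try norm_num
    rename_i q s q' _ _ _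
    rcases hwr (q, s, q') with h | h | h <;> rw [h] <;> norm_num
  exact_mod_cast h

lemma RunW.neg_length_le {Δ : Set (QA × S × QA)} {wA : QA × S × QA → ℤ}
    (hwr : ∀ t, wA t = -1 ∨ wA t = 0 ∨ wA t = 1) {q : QA} {u : List S} {z : ℤ}
    (h : RunW Δ wA q u z) : -(u.length : ℤ) ≤ z := by
  induction h with
  | nil => simp
  | @cons q q' s ρ z _ _ ih =>
    have := hwr (q, s, q')
    push_cast [List.length_cons]
    omega

/-- The stack holding the word `u` on top of `a` copies of `$`. -/
def wordStack (u : List S) (a : ℕ) : List (GSy S) :=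
  u.map GSy.ltr ++ (List.replicate a GSy.dollar ++ [GSy.bot])

lemma exists_head?_wordStack (u : List S) (a : ℕ) : ∃ γ, (wordStack u a).head? = some γ := by
  rcases u with _ | ⟨s, u⟩
  · rcases a with _ | a
    · exact ⟨_, rfl⟩
    · exact ⟨_, rfl⟩
  · exact ⟨_, rfl⟩

section PlayerTwo

/-- The invariant kept by player 2 when every word has a run of nonpositive weight: the weight
so far together with the weight still to be collected in the current round is nonpositive. -/
def SpoilInv (Δ : Set (QA × S × QA)) (wA : QA × S × QA → ℤ) (c : Config (GSt QA) (GSy S))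
    (W : ℤ) : Prop :=
  match c.2 with
  | .qd => ∃ a : ℕ, c.1 = wordStack [] a ∧ W + 10 * a ≤ 0
  | .qs => ∃ (u : List S) (a : ℕ), c.1 = wordStack u a ∧ W + u.length + 10 * a ≤ 0
  | .qch => ∃ (u : List S) (a : ℕ), c.1 = wordStack u a ∧ W + u.length + 10 * a ≤ 0
  | .qlt => False
  | .qa q => ∃ (u : List S) (a : ℕ) (z : ℤ), c.1 = wordStack u a ∧ RunW Δ wA q u z ∧
      W + z + u.length + 10 * a ≤ 0

lemma SpoilInv.nonpos {Δ : Set (QA × S × QA)} {wA : QA × S × QA → ℤ}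
    (hwr : ∀ t, wA t = -1 ∨ wA t = 0 ∨ wA t = 1) {c : Config (GSt QA) (GSy S)} {W : ℤ}
    (h : SpoilInv Δ wA c W) : W ≤ 0 := by
  obtain ⟨α, q⟩ := c
  rcases q with _ | _ | _ | _ | q
  · obtain ⟨a, -, h⟩ := h; omega
  · obtain ⟨u, a, -, h⟩ := h; omega
  · obtain ⟨u, a, -, h⟩ := h; omega
  · exact h.elim
  · obtain ⟨u, a, z, -, hr, h⟩ := h
    have := hr.neg_length_le hwr
    omega

lemma SpoilInv.step_player1 {Δ : Set (QA × S × QA)} {wA : QA × S × QA → ℤ} {q0A : QA}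
    {c : Config (GSt QA) (GSy S)} {W : ℤ} (h : SpoilInv Δ wA c W)
    (hp : c.2 = .qd ∨ c.2 = .qs) {e : Edge (GSt QA) (GSy S)}
    (he : (gadgetGame Δ wA q0A).toWPS.Enabled c e) :
    SpoilInv Δ wA (next c e) (W + gadgetW wA e) := by
  obtain ⟨α, q⟩ := c
  obtain ⟨hE, hq, -⟩ := he
  dsimp only at hp hq
  rcases hp with rfl | rfl
  · obtain ⟨a, ha, hW⟩ := h
    dsimp only at ha
    subst ha
    rcases hE with ⟨γ, rfl⟩ | ⟨γ, rfl⟩ | ⟨γ, s, rfl⟩ | ⟨γ, rfl⟩ | ⟨γ, rfl⟩ | ⟨γ, rfl⟩ |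
      ⟨s, rfl⟩ | rfl | rfl | ⟨q, s, q', hq, rfl⟩ | ⟨q, rfl⟩ | ⟨q, rfl⟩ <;> try cases hq
    · exact ⟨a + 1, rfl, by simp only [gadgetW]; push_cast; omega⟩
    · exact ⟨[], a + 1, rfl, by simp only [gadgetW, List.length_nil]; push_cast; omega⟩
  · obtain ⟨u, a, ha, hW⟩ := h
    dsimp only at ha
    subst ha
    rcases hE with ⟨γ, rfl⟩ | ⟨γ, rfl⟩ | ⟨γ, s, rfl⟩ | ⟨γ, rfl⟩ | ⟨γ, rfl⟩ | ⟨γ, rfl⟩ |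
      ⟨s, rfl⟩ | rfl | rfl | ⟨q, s, q', hq, rfl⟩ | ⟨q, rfl⟩ | ⟨q, rfl⟩ <;> try cases hq
    · exact ⟨s :: u, a, rfl, by simp only [gadgetW, List.length_cons]; push_cast; omega⟩
    · exact ⟨u, a, rfl, by simp only [gadgetW]; omega⟩

lemma SpoilInv.exists_enabled_player1 {Δ : Set (QA × S × QA)} {wA : QA × S × QA → ℤ} {q0A : QA}
    {c : Config (GSt QA) (GSy S)} {W : ℤ} (h : SpoilInv Δ wA c W)
    (hp : c.2 = .qd ∨ c.2 = .qs) :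
    ∃ e, (gadgetGame Δ wA q0A).toWPS.Enabled c e := by
  obtain ⟨α, q⟩ := c
  dsimp only at hp
  rcases hp with rfl | rfl
  · obtain ⟨a, rfl, -⟩ := h
    obtain ⟨γ, hγ⟩ := exists_head?_wordStack ([] : List S) a
    exact ⟨⟨.qd, γ, .qd, .push .dollar⟩, .inl ⟨γ, rfl⟩, rfl, hγ⟩
  · obtain ⟨u, a, rfl, -⟩ := h
    obtain ⟨γ, hγ⟩ := exists_head?_wordStack u a
    exact ⟨⟨.qs, γ, .qch, .skip⟩, .inr (.inr (.inr (.inl ⟨γ, rfl⟩))), rfl, hγ⟩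

lemma SpoilInv.exists_step_player2 {Δ : Set (QA × S × QA)} {wA : QA × S × QA → ℤ} {q0A : QA}
    (hρ : ∀ ρ : List S, ∃ z, RunW Δ wA q0A ρ z ∧ z ≤ 0)
    {c : Config (GSt QA) (GSy S)} {W : ℤ} (h : SpoilInv Δ wA c W)
    (hp : ¬ (c.2 = .qd ∨ c.2 = .qs)) :
    ∃ e, (gadgetGame Δ wA q0A).toWPS.Enabled c e ∧
      SpoilInv Δ wA (next c e) (W + gadgetW wA e) := by
  obtain ⟨α, q⟩ := c
  rcases q with _ | _ | _ | _ | q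
  · simp at hp
  · simp at hp
  · obtain ⟨u, a, rfl, hW⟩ := h
    obtain ⟨γ, hγ⟩ := exists_head?_wordStack u a
    obtain ⟨z, hz, hz0⟩ := hρ u
    refine ⟨⟨.qch, γ, .qa q0A, .skip⟩, ⟨?_, rfl, hγ⟩, u, a, z, rfl, hz, ?_⟩
    · simp [gadgetGame, gadgetE]
    · simp only [gadgetW]
      omega
  · exact h.elim
  · obtain ⟨u, a, z, hα, hr, hW⟩ := h
    dsimp only at hα
    subst hα
    rcases hr with _ | @⟨_, q', s, u, z, hΔ, hr⟩
    · rcases a with _ | a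
      · refine ⟨⟨.qa q, .bot, .qd, .skip⟩, ⟨?_, rfl, rfl⟩, 0, rfl, ?_⟩
        · simp [gadgetGame, gadgetE]
        · simpa [gadgetW] using hW
      · refine ⟨⟨.qa q, .dollar, .qa q, .pop⟩, ⟨?_, rfl, rfl⟩, [], a, 0, rfl, .nil q, ?_⟩
        · simp [gadgetGame, gadgetE]
        · simp only [gadgetW, List.length_nil] at hW ⊢
          push_cast at hW ⊢
          omega
    · refine ⟨⟨.qa q, .ltr s, .qa q', .pop⟩, ⟨?_, rfl, rfl⟩, u, a, z, rfl, hr, ?_⟩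
      · simpa [gadgetGame, gadgetE] using hΔ
      · simp only [gadgetW, List.length_cons] at hW ⊢
        push_cast at hW ⊢
        omega

/-- If every word has a run of nonpositive weight, then every player-1 strategy admits a
consistent play whose averages have nonpositive limit-sup. -/
lemma exists_consistent1_limSupAvg_nonpos {Δ : Set (QA × S × QA)} {wA : QA × S × QA → ℤ}
    {q0A : QA} (hwr : ∀ t, wA t = -1 ∨ wA t = 0 ∨ wA t = 1)
    (hρ : ∀ ρ : List S, ∃ z, RunW Δ wA q0A ρ z ∧ z ≤ 0)
    {σ : Strat (GSt QA) (GSy S)} (hσ : (gadgetGame Δ wA q0A).ValidStrat1 σ) :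
    ∃ f, (gadgetGame Δ wA q0A).Consistent1 σ f ∧
      LimSupAvg (gadgetGame Δ wA q0A).toWPS f ≤ 0 := by
  set G := gadgetGame Δ wA q0A
  obtain ⟨f, hf, hI⟩ := G.exists_consistent1 σ
    (fun es => G.toWPS.Valid G.toWPS.start es ∧
      SpoilInv Δ wA (endc G.toWPS.start es) (G.toWPS.wt es))
    ⟨trivial, 0, rfl, le_rfl⟩ (by
      rintro es ⟨hv, hs⟩
      by_cases hp : G.p1 (endc G.toWPS.start es).2
      · have hen := hσ es hv hp (hs.exists_enabled_player1 hp)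
        refine ⟨σ es, hen, ⟨(G.toWPS.valid_concat _ _ _).2 ⟨hv, hen⟩, ?_⟩, fun _ => rfl⟩
        rw [endc_concat, WPS.wt_concat]
        exact hs.step_player1 hp hen
      · obtain ⟨e, hen, hs'⟩ := hs.exists_step_player2 hρ hp
        refine ⟨e, hen, ⟨(G.toWPS.valid_concat _ _ _).2 ⟨hv, hen⟩, ?_⟩, fun h => (hp h).elim⟩
        rw [endc_concat, WPS.wt_concat]
        exact hs')
  refine ⟨f, hf, limSupAvg_nonpos _ (abs_gadgetW_le hwr) f fun n => ?_⟩
  rw [← WPS.wt_ofFn]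
  exact (hI n).2.nonpos hwr

end PlayerTwo

section PlayerOne

/-- Memory of the counting strategy: whether the state is `q_$`, the top stack symbol, and the
number of symbols pushed since the last skip or pop, capped at `2 * m + 2`. -/
abbrev CountMem (S : Type) (m : ℕ) : Type := Bool × GSy S × Fin (2 * m + 3)

instance [Finite S] : Finite (GSy S) :=
  Finite.of_injective
    (fun x : GSy S => match x with
      | .bot => (none : Option (Option S))
      | .dollar => some none
      | .ltr s => some (some s))
    (by rintro (_ | _ | s) (_ | _ | t) <;> simp)

/-- Memory update of the counting strategy. -/
def countUpd {m : ℕ} (x : CountMem S m) (e : Edge (GSt QA) (GSy S)) : CountMem S m :=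
  (match e.q2 with
    | .qd => true
    | _ => false,
   match e.com with
    | .push z => z
    | _ => e.top,
   match e.com with
    | .push _ => ⟨min (x.2.2 + 1) (2 * m + 2), by omega⟩
    | _ => 0)

/-- Output of the counting strategy for the word `ρ`: push `$` exactly `|ρ| + 1` times, then
push `ρ` so that its first letter ends on top, then hand over to player 2. -/
def countOut (ρ : List S) (x : CountMem S ρ.length) : Edge (GSt QA) (GSy S) :=
  if x.1 then
    if (x.2.2 : ℕ) < ρ.length then ⟨.qd, x.2.1, .qd, .push .dollar⟩
    else ⟨.qd, x.2.1, .qs, .push .dollar⟩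
  else
    match ρ.reverse[(x.2.2 : ℕ) - (ρ.length + 1)]? with
    | some s => ⟨.qs, x.2.1, .qs, .push (.ltr s)⟩
    | none => ⟨.qs, x.2.1, .qch, .skip⟩

/-- Memory content of the counting strategy after a history. -/
def countMem (m : ℕ) (es : List (Edge (GSt QA) (GSy S))) : CountMem S m :=
  es.foldl countUpd (true, .bot, 0)

/-- The counting strategy for the word `ρ`. -/
def countStrat (ρ : List S) : Strat (GSt QA) (GSy S) :=
  fun es => countOut ρ (countMem ρ.length es)

lemma countMem_concat (m : ℕ) (es : List (Edge (GSt QA) (GSy S))) (e : Edge (GSt QA) (GSy S)) :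
    countMem m (es ++ [e]) = countUpd (countMem m es) e := by
  simp [countMem]

lemma finiteMemory_countStrat [Finite S] (ρ : List S) :
    FiniteMemory (countStrat ρ : Strat (GSt QA) (GSy S)) :=
  ⟨CountMem S ρ.length, Fintype.ofFinite _, _, countUpd, countOut ρ, fun _ => rfl⟩

/-- At player-1 configurations the memory knows the state and the top of the stack. -/
lemma countMem_spec {Δ : Set (QA × S × QA)} {wA : QA × S × QA → ℤ} {q0A : QA} (m : ℕ)
    (es : List (Edge (GSt QA) (GSy S)))
    (hv : (gadgetGame Δ wA q0A).toWPS.Valid (gadgetGame Δ wA q0A).toWPS.start es) :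
    let c := endc (gadgetGame Δ wA q0A).toWPS.start es
    (c.2 = .qd → (countMem m es).1 = true ∧ c.1.head? = some (countMem m es).2.1) ∧
    (c.2 = .qs → (countMem m es).1 = false ∧ c.1.head? = some (countMem m es).2.1) := by
  rcases List.eq_nil_or_concat' es with rfl | ⟨es, e, rfl⟩
  · exact ⟨fun _ => ⟨rfl, rfl⟩, fun h => by cases h⟩
  · rw [WPS.valid_concat] at hv
    obtain ⟨hE, -, ht⟩ := hv.2
    intro c
    simp only [c, endc_concat, countMem_concat]
    rcases hE with ⟨γ, rfl⟩ | ⟨γ, rfl⟩ | ⟨γ, s, rfl⟩ | ⟨γ, rfl⟩ | ⟨γ, rfl⟩ | ⟨γ, rfl⟩ |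
      ⟨s, rfl⟩ | rfl | rfl | ⟨q, s, q', hq, rfl⟩ | ⟨q, rfl⟩ | ⟨q, rfl⟩ <;>
      simp_all [next, Com.apply, countUpd]

lemma validStrat1_countStrat (Δ : Set (QA × S × QA)) (wA : QA × S × QA → ℤ) (q0A : QA)
    (ρ : List S) : (gadgetGame Δ wA q0A).ValidStrat1 (countStrat ρ) := by
  intro es hv hp _
  obtain ⟨hd, hs⟩ := countMem_spec ρ.length es hv
  rcases hp with hp | hp
  · obtain ⟨h1, h2⟩ := hd hp
    simp only [countStrat, countOut, h1, if_true]
    split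
    · exact ⟨.inl ⟨_, rfl⟩, hp, h2⟩
    · exact ⟨.inr (.inl ⟨_, rfl⟩), hp, h2⟩
  · obtain ⟨h1, h2⟩ := hs hp
    simp only [countStrat, countOut, h1, Bool.false_eq_true, if_false]
    split
    · exact ⟨.inr (.inr (.inl ⟨_, _, rfl⟩)), hp, h2⟩
    · exact ⟨.inr (.inr (.inr (.inl ⟨_, rfl⟩))), hp, h2⟩

/-- The invariant of plays consistent with the counting strategy after `n` steps and weight `W`,
where `k` rounds, each of length `4 * |ρ| + 5`, have been completed. -/
def RoundInv (Δ : Set (QA × S × QA)) (wA : QA × S × QA → ℤ) (ρ : List S) (n k : ℕ) (W : ℤ)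
    (c : Config (GSt QA) (GSy S)) (x : CountMem S ρ.length) : Prop :=
  (k : ℤ) ≤ W + 11 * (ρ.length + 1) ∧
  match c.2 with
  | .qd => ∃ a : ℕ, c.1 = wordStack [] a ∧ a ≤ ρ.length ∧ x.1 = true ∧ (x.2.2 : ℕ) = a ∧
      (k : ℤ) ≤ W + 10 * a ∧ n = k * (4 * ρ.length + 5) + a
  | .qs => ∃ v u : List S, c.1 = wordStack u (ρ.length + 1) ∧ ρ = v ++ u ∧ x.1 = false ∧
      (x.2.2 : ℕ) = ρ.length + 1 + u.length ∧
      (k : ℤ) ≤ W + 10 * (ρ.length + 1) + u.length ∧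
      n = k * (4 * ρ.length + 5) + (ρ.length + 1 + u.length)
  | .qch => c.1 = wordStack ρ (ρ.length + 1) ∧
      (k : ℤ) ≤ W + 10 * (ρ.length + 1) + ρ.length ∧
      n = k * (4 * ρ.length + 5) + (2 * ρ.length + 2)
  | .qlt => ∃ (u : List S) (a : ℕ), c.1 = wordStack u a ∧ (k : ℤ) + 1 ≤ W + 11 * a ∧
      n + (u.length + a + 1) = k * (4 * ρ.length + 5) + (4 * ρ.length + 5)
  | .qa q => ∃ (u : List S) (a : ℕ), c.1 = wordStack u a ∧
      (∀ z, RunW Δ wA q u z → (k : ℤ) + 1 ≤ W + z + u.length + 10 * a) ∧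
      n + (u.length + a + 1) = k * (4 * ρ.length + 5) + (4 * ρ.length + 5)

lemma RoundInv.le_mul {Δ : Set (QA × S × QA)} {wA : QA × S × QA → ℤ} {ρ : List S} {n k : ℕ}
    {W : ℤ} {c : Config (GSt QA) (GSy S)} {x : CountMem S ρ.length}
    (h : RoundInv Δ wA ρ n k W c x) : n ≤ k * (4 * ρ.length + 5) + (4 * ρ.length + 5) := by
  obtain ⟨α, q⟩ := c
  obtain ⟨-, h⟩ := h
  rcases q with _ | _ | _ | _ | q
  · obtain ⟨a, -, _, -, -, -, h⟩ := h; omega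
  · obtain ⟨v, u, -, hρ, -, -, -, h⟩ := h
    have : ρ.length = v.length + u.length := by rw [hρ, List.length_append]
    omega
  · obtain ⟨-, -, h⟩ := h; omega
  · obtain ⟨u, a, -, -, h⟩ := h; omega
  · obtain ⟨u, a, -, -, h⟩ := h; omega

lemma RoundInv.step {Δ : Set (QA × S × QA)} {wA : QA × S × QA → ℤ} {q0A : QA}
    (hwr : ∀ t, wA t = -1 ∨ wA t = 0 ∨ wA t = 1) {ρ : List S}
    (hρ : ∀ z, RunW Δ wA q0A ρ z → 1 ≤ z) {n k : ℕ}
    {W : ℤ} {c : Config (GSt QA) (GSy S)} {x : CountMem S ρ.length}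
    (h : RoundInv Δ wA ρ n k W c x) {e : Edge (GSt QA) (GSy S)}
    (he : (gadgetGame Δ wA q0A).toWPS.Enabled c e)
    (hp : c.2 = .qd ∨ c.2 = .qs → e = countOut ρ x) :
    ∃ k', RoundInv Δ wA ρ (n + 1) k' (W + gadgetW wA e) (next c e) (countUpd x e) := by
  obtain ⟨α, q⟩ := c
  obtain ⟨hk, h⟩ := h
  obtain ⟨hE, hq, ht⟩ := he
  dsimp only at hp hq ht
  rcases q with _ | _ | _ | _ | q
  · obtain ⟨a, ha, ham, hx, hxa, hW, hn⟩ := h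
    dsimp only at ha
    subst ha
    have he := hp (.inl rfl)
    simp only [countOut, hx, if_true] at he
    split at he
    · subst he
      refine ⟨k, ?_, a + 1, rfl, by omega, rfl, ?_, ?_, by omega⟩
      · simp only [gadgetW]; omega
      · simp only [countUpd]; omega
      · simp only [gadgetW]; push_cast; omega
    · subst he
      have : a = ρ.length := by omega
      subst this
      refine ⟨k, ?_, ρ, [], rfl, by simp, rfl, ?_, ?_, ?_⟩
      · simp only [gadgetW]; omega
      · simp only [countUpd, List.length_nil]; omega
      · simp only [gadgetW, List.length_nil]; push_cast; omega
      · simp only [List.length_nil]; omega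
  · obtain ⟨v, u, hα, hvu, hx, hxa, hW, hn⟩ := h
    dsimp only at hα
    subst hα
    have hlen : ρ.length = v.length + u.length := by rw [hvu, List.length_append]
    have he := hp (.inr rfl)
    have hidx : ρ.length + 1 + u.length - (ρ.length + 1) = u.reverse.length := by
      rw [List.length_reverse]; omega
    have hrev : ρ.reverse = u.reverse ++ v.reverse := by rw [hvu, List.reverse_append]
    simp only [countOut, hx, hxa, hidx, hrev, Bool.false_eq_true, if_false] at he
    rw [List.getElem?_append_right le_rfl, Nat.sub_self] at he
    rcases List.eq_nil_or_concat' v with rfl | ⟨v, s, rfl⟩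
    · simp only [List.reverse_nil, List.getElem?_nil] at he
      subst he
      simp only [List.nil_append] at hvu
      subst hvu
      refine ⟨k, ?_, rfl, ?_, by omega⟩
      · simp only [gadgetW]; omega
      · simp only [gadgetW]; omega
    · simp only [List.reverse_append, List.reverse_cons, List.reverse_nil, List.nil_append,
        List.cons_append, List.getElem?_cons_zero] at he
      subst he
      simp only [List.length_append, List.length_cons, List.length_nil] at hlen
      refine ⟨k, ?_, v, s :: u, rfl, by simpa using hvu, rfl, ?_, ?_, ?_⟩
      · simp only [gadgetW]; omega
      · simp only [countUpd, List.length_cons]; omega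
      · simp only [gadgetW, List.length_cons]; push_cast; omega
      · simp only [List.length_cons]; omega
  · obtain ⟨hα, hW, hn⟩ := h
    dsimp only at hα
    subst hα
    rcases hE with ⟨γ, rfl⟩ | ⟨γ, rfl⟩ | ⟨γ, s, rfl⟩ | ⟨γ, rfl⟩ | ⟨γ, rfl⟩ | ⟨γ, rfl⟩ |
      ⟨s, rfl⟩ | rfl | rfl | ⟨q, s, q', hq, rfl⟩ | ⟨q, rfl⟩ | ⟨q, rfl⟩ <;> try cases hq
    · refine ⟨k, ?_, ρ, ρ.length + 1, rfl, ?_, by omega⟩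
      · simp only [gadgetW]; omega
      · simp only [gadgetW]; push_cast; omega
    · refine ⟨k, ?_, ρ, ρ.length + 1, rfl, fun z hz => ?_, by omega⟩
      · simp only [gadgetW]; omega
      · have := hρ z hz
        simp only [gadgetW]; push_cast; omega
  · obtain ⟨u, a, hα, hW, hn⟩ := h
    dsimp only at hα
    subst hα
    rcases u with _ | ⟨s, u⟩
    · rcases a with _ | a
      · rcases hE with ⟨γ, rfl⟩ | ⟨γ, rfl⟩ | ⟨γ, s, rfl⟩ | ⟨γ, rfl⟩ | ⟨γ, rfl⟩ | ⟨γ, rfl⟩ |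
          ⟨s, rfl⟩ | rfl | rfl | ⟨q, s, q', hΔ, rfl⟩ | ⟨q, rfl⟩ | ⟨q, rfl⟩ <;>
          cases hq <;> cases ht
        simp only [List.length_nil] at hn
        refine ⟨k + 1, ?_, 0, rfl, by omega, rfl, rfl, ?_, ?_⟩
        · simp only [gadgetW]; push_cast at hW ⊢; omega
        · simp only [gadgetW]; push_cast at hW ⊢; omega
        · rw [add_one_mul]; omega
      · rcases hE with ⟨γ, rfl⟩ | ⟨γ, rfl⟩ | ⟨γ, s, rfl⟩ | ⟨γ, rfl⟩ | ⟨γ, rfl⟩ | ⟨γ, rfl⟩ |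
          ⟨s, rfl⟩ | rfl | rfl | ⟨q, s, q', hΔ, rfl⟩ | ⟨q, rfl⟩ | ⟨q, rfl⟩ <;>
          cases hq <;> cases ht
        refine ⟨k, ?_, [], a, rfl, ?_, ?_⟩
        · simp only [gadgetW]; omega
        · simp only [gadgetW]; push_cast at hW; omega
        · omega
    · rcases hE with ⟨γ, rfl⟩ | ⟨γ, rfl⟩ | ⟨γ, s, rfl⟩ | ⟨γ, rfl⟩ | ⟨γ, rfl⟩ | ⟨γ, rfl⟩ |
        ⟨s, rfl⟩ | rfl | rfl | ⟨q, s, q', hΔ, rfl⟩ | ⟨q, rfl⟩ | ⟨q, rfl⟩ <;>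
        cases hq <;> cases ht
      simp only [List.length_cons] at hn
      refine ⟨k, ?_, u, a, rfl, ?_, by omega⟩
      · simp only [gadgetW]; omega
      · simp only [gadgetW]; omega
  · obtain ⟨u, a, hα, hW, hn⟩ := h
    dsimp only at hα
    subst hα
    rcases u with _ | ⟨s, u⟩
    · have hW := hW 0 (.nil q)
      rcases a with _ | a
      · rcases hE with ⟨γ, rfl⟩ | ⟨γ, rfl⟩ | ⟨γ, s, rfl⟩ | ⟨γ, rfl⟩ | ⟨γ, rfl⟩ | ⟨γ, rfl⟩ |
          ⟨s, rfl⟩ | rfl | rfl | ⟨q, s, q', hΔ, rfl⟩ | ⟨q, rfl⟩ | ⟨q, rfl⟩ <;>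
          cases hq <;> cases ht
        simp only [List.length_nil] at hn hW
        refine ⟨k + 1, ?_, 0, rfl, by omega, rfl, rfl, ?_, ?_⟩
        · simp only [gadgetW]; push_cast at hW ⊢; omega
        · simp only [gadgetW]; push_cast at hW ⊢; omega
        · rw [add_one_mul]; omega
      · rcases hE with ⟨γ, rfl⟩ | ⟨γ, rfl⟩ | ⟨γ, s, rfl⟩ | ⟨γ, rfl⟩ | ⟨γ, rfl⟩ | ⟨γ, rfl⟩ |
          ⟨s, rfl⟩ | rfl | rfl | ⟨q, s, q', hΔ, rfl⟩ | ⟨q, rfl⟩ | ⟨q, rfl⟩ <;>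
          cases hq <;> cases ht
        refine ⟨k, ?_, [], a, rfl, fun z hz => ?_, ?_⟩
        · simp only [gadgetW]; omega
        · cases hz
          simp only [gadgetW, List.length_nil] at hW ⊢; push_cast at hW ⊢; omega
        · omega
    · rcases hE with ⟨γ, rfl⟩ | ⟨γ, rfl⟩ | ⟨γ, s, rfl⟩ | ⟨γ, rfl⟩ | ⟨γ, rfl⟩ | ⟨γ, rfl⟩ |
        ⟨s, rfl⟩ | rfl | rfl | ⟨q, s, q', hΔ, rfl⟩ | ⟨q, rfl⟩ | ⟨q, rfl⟩ <;>
        cases hq <;> cases ht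
      simp only [List.length_cons] at hn
      refine ⟨k, ?_, u, a, rfl, fun z hz => ?_, by omega⟩
      · have := hwr (q, s, q')
        simp only [gadgetW]; omega
      · have := hW _ (.cons hΔ hz)
        simp only [gadgetW, List.length_cons] at this ⊢
        push_cast at this
        omega

lemma exists_roundInv {Δ : Set (QA × S × QA)} {wA : QA × S × QA → ℤ} {q0A : QA}
    (hwr : ∀ t, wA t = -1 ∨ wA t = 0 ∨ wA t = 1) {ρ : List S}
    (hρ : ∀ z, RunW Δ wA q0A ρ z → 1 ≤ z) {f : ℕ → Edge (GSt QA) (GSy S)}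
    (hf : (gadgetGame Δ wA q0A).Consistent1 (countStrat ρ) f) (n : ℕ) :
    ∃ k, RoundInv Δ wA ρ n k (∑ i ∈ Finset.range n, gadgetW wA (f i))
      (confs (gadgetGame Δ wA q0A).toWPS.start f n)
      (countMem ρ.length (List.ofFn fun i : Fin n => f i)) := by
  induction n with
  | zero =>
    refine ⟨0, ?_, 0, rfl, Nat.zero_le _, rfl, rfl, ?_, ?_⟩
    · simp only [Finset.range_zero, Finset.sum_empty]; omega
    · simp
    · simp
  | succ n ih =>
    obtain ⟨k, hk⟩ := ih
    rw [ofFn_succ_eq_concat, countMem_concat, Finset.sum_range_succ]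
    exact hk.step hwr hρ (hf.1 n) (hf.2 n)

lemma limInfAvg_pos_of_consistent1_countStrat {Δ : Set (QA × S × QA)} {wA : QA × S × QA → ℤ}
    {q0A : QA} (hwr : ∀ t, wA t = -1 ∨ wA t = 0 ∨ wA t = 1) {ρ : List S}
    (hρ : ∀ z, RunW Δ wA q0A ρ z → 1 ≤ z) {f : ℕ → Edge (GSt QA) (GSy S)}
    (hf : (gadgetGame Δ wA q0A).Consistent1 (countStrat ρ) f) :
    0 < LimInfAvg (gadgetGame Δ wA q0A).toWPS f := by
  have hL : (0 : ℝ) < 4 * ρ.length + 5 := by positivity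
  refine limInfAvg_pos _ (abs_gadgetW_le hwr) f
    ((4 * ρ.length + 5) * (11 * (ρ.length + 1) + 1)) hL fun n => ?_
  obtain ⟨k, hk⟩ := exists_roundInv hwr hρ hf n
  have h1 : (n : ℝ) ≤ k * (4 * ρ.length + 5) + (4 * ρ.length + 5) := by exact_mod_cast hk.le_mul
  have h2 : (k : ℝ) ≤ (∑ i ∈ Finset.range n, (gadgetW wA (f i) : ℝ)) + 11 * (ρ.length + 1) := by
    exact_mod_cast hk.1
  have h3 := mul_le_mul_of_nonneg_right h2 hL.le
  change (n : ℝ) ≤ (4 * ρ.length + 5) * (∑ i ∈ Finset.range n, (gadgetW wA (f i) : ℝ)) + _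
  linarith

end PlayerOne

end PDS

open PDS in
/-- correctness of the five-gadget reduction from the non-universality
problem of weighted finite automata (weights in `{-1,0,1}`) to mean-payoff pushdown
games: (1) if some word has value at least `1`, player 1 has a finite-memory winning
strategy for the objectives `LimSupAvg > 0` and `LimInfAvg > 0`; (2) if every word
has value at most `0`, player 1 has no winning strategy for either objective;
(3) consequently, existence of a winning strategy (equivalently of a finite-memory
winning strategy) for both objectives is equivalent to the existence of a word of
value at least `1`. -/
theorem gadget_reduction_correct
    {S QA : Type} [Fintype S] [Fintype QA]
    (Δ : Set (QA × S × QA)) (wA : QA × S × QA → ℤ) (q0A : QA)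
    (hwr : ∀ t, wA t = -1 ∨ wA t = 0 ∨ wA t = 1) :
    ((∃ ρ : List S, ∀ z, RunW Δ wA q0A ρ z → 1 ≤ z) →
      ∃ σ, FiniteMemory σ ∧
        (gadgetGame Δ wA q0A).Winning1 σ
          (fun f => 0 < LimSupAvg (gadgetGame Δ wA q0A).toWPS f ∧
            0 < LimInfAvg (gadgetGame Δ wA q0A).toWPS f)) ∧
    ((∀ ρ : List S, ∃ z, RunW Δ wA q0A ρ z ∧ z ≤ 0) →
      (¬ ∃ σ, (gadgetGame Δ wA q0A).Winning1 σ
          (fun f => 0 < LimSupAvg (gadgetGame Δ wA q0A).toWPS f)) ∧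
      (¬ ∃ σ, (gadgetGame Δ wA q0A).Winning1 σ
          (fun f => 0 < LimInfAvg (gadgetGame Δ wA q0A).toWPS f))) ∧
    ((∃ σ, (gadgetGame Δ wA q0A).Winning1 σ
        (fun f => 0 < LimSupAvg (gadgetGame Δ wA q0A).toWPS f ∧
          0 < LimInfAvg (gadgetGame Δ wA q0A).toWPS f)) ↔
      (∃ ρ : List S, ∀ z, RunW Δ wA q0A ρ z → 1 ≤ z)) ∧
    ((∃ σ, FiniteMemory σ ∧ (gadgetGame Δ wA q0A).Winning1 σ
        (fun f => 0 < LimSupAvg (gadgetGame Δ wA q0A).toWPS f ∧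
          0 < LimInfAvg (gadgetGame Δ wA q0A).toWPS f)) ↔
      (∃ ρ : List S, ∀ z, RunW Δ wA q0A ρ z → 1 ≤ z)) := by
  have hwin : (∃ ρ : List S, ∀ z, RunW Δ wA q0A ρ z → 1 ≤ z) →
      ∃ σ, FiniteMemory σ ∧ (gadgetGame Δ wA q0A).Winning1 σ
        (fun f => 0 < LimSupAvg (gadgetGame Δ wA q0A).toWPS f ∧
          0 < LimInfAvg (gadgetGame Δ wA q0A).toWPS f) := by
    rintro ⟨ρ, hρ⟩
    refine ⟨countStrat ρ, finiteMemory_countStrat ρ, validStrat1_countStrat Δ wA q0A ρ,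
      fun f hf => ?_⟩
    have hpos := limInfAvg_pos_of_consistent1_countStrat hwr hρ hf
    exact ⟨hpos.trans_le (limInfAvg_le_limSupAvg _ (abs_gadgetW_le hwr) f), hpos⟩
  have hlose : (∀ ρ : List S, ∃ z, RunW Δ wA q0A ρ z ∧ z ≤ 0) →
      (¬ ∃ σ, (gadgetGame Δ wA q0A).Winning1 σ
          (fun f => 0 < LimSupAvg (gadgetGame Δ wA q0A).toWPS f)) ∧
      (¬ ∃ σ, (gadgetGame Δ wA q0A).Winning1 σ
          (fun f => 0 < LimInfAvg (gadgetGame Δ wA q0A).toWPS f)) := by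
    intro h
    constructor
    · rintro ⟨σ, hσ, hobj⟩
      obtain ⟨f, hf, hle⟩ := exists_consistent1_limSupAvg_nonpos hwr h hσ
      exact (hobj f hf).not_ge hle
    · rintro ⟨σ, hσ, hobj⟩
      obtain ⟨f, hf, hle⟩ := exists_consistent1_limSupAvg_nonpos hwr h hσ
      exact (hobj f hf).not_ge ((limInfAvg_le_limSupAvg _ (abs_gadgetW_le hwr) f).trans hle)
  have hword : (∃ σ, (gadgetGame Δ wA q0A).Winning1 σ
        (fun f => 0 < LimSupAvg (gadgetGame Δ wA q0A).toWPS f ∧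
          0 < LimInfAvg (gadgetGame Δ wA q0A).toWPS f)) →
      ∃ ρ : List S, ∀ z, RunW Δ wA q0A ρ z → 1 ≤ z := by
    rintro ⟨σ, hσ, hobj⟩
    by_contra! hno
    refine (hlose fun ρ => ?_).1 ⟨σ, hσ, fun f hf => (hobj f hf).1⟩
    obtain ⟨z, hz, hlt⟩ := hno ρ
    exact ⟨z, hz, Int.lt_add_one_iff.1 hlt⟩
  refine ⟨hwin, hlose, ⟨hword, fun h => ?_⟩, ⟨fun ⟨σ, _, hσ⟩ => hword ⟨σ, hσ⟩, hwin⟩⟩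
  obtain ⟨σ, -, hσ⟩ := hwin h
  exact ⟨σ, hσ⟩
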